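/- Let a, b be real numbers with 0 < a < b and let α be a real number with 0 < |α| < 1/4. Then ∫₀^∞ K_α²(a x) K_α²(b x) dx = (π⁴/(8b)) csc(2πα) · { [csc(πα) Γ(2α+1/2) / (Γ(1/2−α) Γ(1+α)³)] (a/(2b))^{2α} · ₄F₃(1/2, α+1/2, α+1/2, 2α+1/2; 2α+1, α+1, α+1; a²/b²) + [csc(πα) Γ(1/2−2α) / (Γ(α+1/2) Γ(1−α)³)] (a/(2b))^{−2α} · ₄F₃(1/2, 1/2−2α, 1/2−α, 1/2−α; 1−2α, 1−α, 1−α; a²/b²) − (2/(πα)) · ₄F₃(1/2, 1/2, α+1/2, 1/2−α; 1, 1−α, α+1; a²/b²) }. -/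

import Mathlib

open MeasureTheory Real

noncomputable def besselK (ν x : ℝ) : ℝ :=
  ∫ t in Set.Ioi (0:ℝ), Real.exp (-x * Real.cosh t) * Real.cosh (ν * t)
noncomputable def poch (u : ℝ) (k : ℕ) : ℝ := ∏ i ∈ Finset.range k, (u + (i : ℝ))
noncomputable def hyp4F3 (a₁ a₂ a₃ a₄ b₁ b₂ b₃ z : ℝ) : ℝ :=
  ∑' k : ℕ, (poch a₁ k * poch a₂ k * poch a₃ k * poch a₄ k)
    / (poch b₁ k * poch b₂ k * poch b₃ k) * z ^ k / (k.factorial : ℝ)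
open Filter Topology

section ExpCosh

lemma lintegral_Ioi_zero_eq_lintegral_exp (f : ℝ → ENNReal) :
    ∫⁻ x in Set.Ioi (0:ℝ), f x = ∫⁻ w : ℝ, ENNReal.ofReal (exp w) * f (exp w) := by
  have h := lintegral_image_eq_lintegral_abs_deriv_mul (s := Set.univ) (f := exp) (f' := exp)
    MeasurableSet.univ (fun x _ => (hasDerivAt_exp x).hasDerivWithinAt) exp_injective.injOn f
  rw [Set.image_univ, range_exp] at h
  simpa [abs_of_pos (exp_pos _)] using h

lemma lintegral_exp_neg_mul_exp_add {a c : ℝ} (ha : 0 < a) (hc : 0 < c) :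
    ∫⁻ p : ℝ, ENNReal.ofReal (exp (-(c * exp p) + a * p))
      = ENNReal.ofReal (Gamma a * c ^ (-a)) := by
  have hv := Real.integral_rpow_mul_exp_neg_mul_Ioi ha hc
  have hpos : 0 < (1 / c) ^ a * Gamma a := by have := Gamma_pos_of_pos ha; positivity
  have hint : IntegrableOn (fun t : ℝ => t ^ (a - 1) * exp (-(c * t))) (Set.Ioi 0) := by
    by_contra hn
    rw [integral_undef hn] at hv
    exact hpos.ne hv
  have h := ofReal_integral_eq_lintegral_ofReal hint
    ((ae_restrict_iff' measurableSet_Ioi).2 (ae_of_all _ fun t (ht : 0 < t) => by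
      simp only [Pi.zero_apply]; positivity))
  rw [hv, lintegral_Ioi_zero_eq_lintegral_exp] at h
  have e : Gamma a * c ^ (-a) = (1 / c) ^ a * Gamma a := by
    rw [one_div, inv_rpow hc.le, rpow_neg hc.le, mul_comm]
  rw [e, h]
  refine lintegral_congr fun p => ?_
  rw [← ENNReal.ofReal_mul (exp_pos p).le, ← exp_mul, ← exp_add, ← exp_add]
  congr 2
  ring

lemma integrable_of_lintegral_ofReal_lt_top {f : ℝ → ℝ} (hf : Measurable f) (h0 : ∀ x, 0 ≤ f x)
    (h : ∫⁻ x, ENNReal.ofReal (f x) < ⊤) : Integrable f :=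
  (lintegral_ofReal_ne_top_iff_integrable hf.aestronglyMeasurable (ae_of_all _ h0)).1 h.ne

lemma integrable_exp_neg_mul_exp_add {a c : ℝ} (ha : 0 < a) (hc : 0 < c) :
    Integrable fun p : ℝ => exp (-(c * exp p) + a * p) :=
  integrable_of_lintegral_ofReal_lt_top (by fun_prop) (fun _ => (exp_pos _).le)
    (by rw [lintegral_exp_neg_mul_exp_add ha hc]; exact ENNReal.ofReal_lt_top)

lemma integrable_exp_neg_mul_cosh_add {x : ℝ} (hx : 0 < x) (ν : ℝ) :
    Integrable fun t : ℝ => exp (-x * cosh t + ν * t) := by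
  have hm : 0 < |ν| + 1 := by positivity
  have h1 := integrable_exp_neg_mul_exp_add hm (half_pos hx)
  refine (h1.add h1.comp_neg).mono' (by fun_prop) (ae_of_all _ fun t => ?_)
  rw [norm_of_nonneg (exp_pos _).le, Pi.add_apply]
  have e1 := exp_pos t
  have e2 := exp_pos (-t)
  have hc : cosh t = (exp t + exp (-t)) / 2 := cosh_eq t
  rcases le_total 0 t with ht | ht
  · have : exp (-x * cosh t + ν * t) ≤ exp (-(x / 2 * exp t) + (|ν| + 1) * t) := by
      rw [exp_le_exp, hc]
      nlinarith [le_abs_self ν, mul_pos hx e2]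
    linarith [exp_pos (-(x / 2 * exp (-t)) + (|ν| + 1) * -t)]
  · have : exp (-x * cosh t + ν * t) ≤ exp (-(x / 2 * exp (-t)) + (|ν| + 1) * -t) := by
      rw [exp_le_exp, hc]
      nlinarith [neg_abs_le ν, mul_pos hx e1]
    linarith [exp_pos (-(x / 2 * exp t) + (|ν| + 1) * t)]

lemma integrable_exp_neg_mul_cosh_mul_cosh {x : ℝ} (hx : 0 < x) (ν : ℝ) :
    Integrable fun t : ℝ => exp (-x * cosh t) * cosh (ν * t) := by
  have h := ((integrable_exp_neg_mul_cosh_add hx ν).add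
    (integrable_exp_neg_mul_cosh_add hx (-ν))).div_const 2
  refine h.congr (ae_of_all _ fun t => ?_)
  simp only [Pi.add_apply, cosh_eq (ν * t), exp_add, neg_mul]
  ring

lemma integral_exp_neg_mul_cosh_add {x : ℝ} (hx : 0 < x) (ν : ℝ) :
    ∫ t : ℝ, exp (-x * cosh t + ν * t) = 2 * besselK ν x := by
  have hneg : ∫ t : ℝ, exp (-x * cosh t + ν * t) = ∫ t : ℝ, exp (-x * cosh t + -ν * t) := by
    rw [← integral_neg_eq_self]
    simp
  have hsum : ∫ t : ℝ, exp (-x * cosh t + ν * t)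
      = ∫ t : ℝ, exp (-x * cosh t) * cosh (ν * t) := by
    have h2 := integral_add (integrable_exp_neg_mul_cosh_add hx ν)
      (integrable_exp_neg_mul_cosh_add hx (-ν))
    rw [← hneg] at h2
    have h3 : ∫ t : ℝ, (exp (-x * cosh t + ν * t) + exp (-x * cosh t + -ν * t))
        = ∫ t : ℝ, 2 * (exp (-x * cosh t) * cosh (ν * t)) := by
      refine integral_congr_ae (ae_of_all _ fun t => ?_)
      simp only [cosh_eq (ν * t), exp_add, neg_mul]
      ring
    rw [h3, integral_const_mul] at h2
    linarith
  rw [hsum, besselK]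
  have h := integral_comp_abs (f := fun t => exp (-x * cosh t) * cosh (ν * t))
  rw [← h]
  refine integral_congr_ae (ae_of_all _ fun t => ?_)
  rcases abs_choice t with h | h <;> simp [h]

end ExpCosh

section MellinSquare

lemma lintegral_exp_mul_one_add_exp_rpow {a b : ℝ} (ha : 0 < a) (hb : 0 < b) :
    ∫⁻ r : ℝ, ENNReal.ofReal (exp (b * r) * (1 + exp r) ^ (-(a + b)))
      = ENNReal.ofReal (Gamma a * Gamma b / Gamma (a + b)) := by
  have hab : 0 < a + b := add_pos ha hb
  have hG : 0 < Gamma (a + b) := Gamma_pos_of_pos hab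
  have h1 : ENNReal.ofReal (Gamma a) * ENNReal.ofReal (Gamma b)
      = ∫⁻ p : ℝ, ∫⁻ r : ℝ,
          ENNReal.ofReal (exp (-((1 + exp r) * exp p) + (a + b) * p)) *
            ENNReal.ofReal (exp (b * r)) := by
    have ga := lintegral_exp_neg_mul_exp_add ha one_pos
    have gb := lintegral_exp_neg_mul_exp_add hb one_pos
    rw [one_rpow, mul_one] at ga gb
    rw [← ga, ← gb, ← lintegral_mul_const _ (by fun_prop)]
    refine lintegral_congr fun p => ?_
    rw [← lintegral_add_right_eq_self _ p, ← lintegral_const_mul _ (by fun_prop)]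
    refine lintegral_congr fun r => ?_
    rw [← ENNReal.ofReal_mul (exp_pos _).le, ← ENNReal.ofReal_mul (exp_pos _).le,
      ← exp_add, ← exp_add, exp_add r p]
    congr 2
    ring
  rw [lintegral_lintegral_swap (by fun_prop)] at h1
  have h2 : ∀ r : ℝ, ∫⁻ p : ℝ, ENNReal.ofReal (exp (-((1 + exp r) * exp p) + (a + b) * p)) *
            ENNReal.ofReal (exp (b * r))
      = ENNReal.ofReal (Gamma (a + b)) *
        ENNReal.ofReal (exp (b * r) * (1 + exp r) ^ (-(a + b))) := fun r => by
    have hr : 0 < 1 + exp r := by positivity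
    rw [lintegral_mul_const _ (by fun_prop), lintegral_exp_neg_mul_exp_add hab hr,
      ← ENNReal.ofReal_mul (by positivity), ← ENNReal.ofReal_mul hG.le]
    congr 1
    ring
  simp_rw [h2] at h1
  rw [lintegral_const_mul _ (by fun_prop), ← ENNReal.ofReal_mul (Gamma_pos_of_pos ha).le] at h1
  rw [ENNReal.ofReal_div_of_pos hG, h1, mul_comm, ENNReal.mul_div_cancel_right]
  · simpa using hG
  · exact ENNReal.ofReal_ne_top

lemma lintegral_exp_mul_cosh_half_rpow {s α : ℝ} (h1 : 0 < s / 2 + α) (h2 : 0 < s / 2 - α) :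
    ∫⁻ p : ℝ, ENNReal.ofReal (exp (α * p) * cosh (p / 2) ^ (-s))
      = ENNReal.ofReal (2 ^ s * (Gamma (s / 2 + α) * Gamma (s / 2 - α) / Gamma s)) := by
  have h := lintegral_exp_mul_one_add_exp_rpow h2 h1
  have e : s / 2 - α + (s / 2 + α) = s := by ring
  rw [e] at h
  rw [mul_comm (Gamma (s / 2 + α)), ENNReal.ofReal_mul (by positivity), ← h,
    ← lintegral_const_mul _ (by fun_prop)]
  refine lintegral_congr fun p => ?_
  rw [← ENNReal.ofReal_mul (by positivity)]
  congr 1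
  have hc : cosh (p / 2) = (1 + exp p) * exp (-(p / 2)) * 2⁻¹ := by
    rw [cosh_eq, add_mul, ← exp_add, show p + -(p / 2) = p / 2 by ring]
    ring
  rw [hc, mul_rpow (by positivity) (by positivity), mul_rpow (by positivity) (by positivity),
    ← exp_mul, inv_rpow (by positivity), rpow_neg (by positivity : (0:ℝ) ≤ 2), inv_inv,
    show (s / 2 + α) * p = α * p + -(p / 2) * -s by ring, exp_add]
  ring

lemma lintegral_comp_div_two {f : ℝ → ENNReal} (hf : Measurable f) :
    ∫⁻ p : ℝ, f (p / 2) = 2 * ∫⁻ t : ℝ, f t := by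
  have h := lintegral_image_eq_lintegral_abs_deriv_mul (s := Set.univ) (f := fun t : ℝ => 2 * t)
    (f' := fun _ => 2) MeasurableSet.univ
    (fun x _ => HasDerivAt.hasDerivWithinAt (by simpa using (hasDerivAt_id x).const_mul (2:ℝ)))
    (fun x _ y _ h => by simpa using h) (fun p => f (p / 2))
  rw [Set.image_univ, Set.range_eq_univ.2 (fun y => ⟨y / 2, by ring⟩)] at h
  simp only [Measure.restrict_univ] at h
  rw [h, ← lintegral_const_mul _ hf]
  simp

lemma lintegral_cosh_rpow {s : ℝ} (hs : 0 < s) :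
    ∫⁻ t : ℝ, ENNReal.ofReal (cosh t ^ (-s))
      = ENNReal.ofReal (2 ^ s * (Gamma (s / 2) ^ 2 / Gamma s) / 2) := by
  have h := lintegral_exp_mul_cosh_half_rpow (s := s) (α := 0) (by linarith) (by linarith)
  simp only [zero_mul, exp_zero, one_mul, add_zero, sub_zero] at h
  rw [lintegral_comp_div_two (f := fun t => ENNReal.ofReal (cosh t ^ (-s))) (by fun_prop)] at h
  rw [ENNReal.ofReal_div_of_pos two_pos, sq, ← h, ENNReal.ofReal_ofNat, mul_comm,
    ENNReal.mul_div_cancel_right two_ne_zero ENNReal.ofNat_ne_top]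

lemma ofReal_four_mul_besselK_sq {x : ℝ} (hx : 0 < x) (α : ℝ) :
    ENNReal.ofReal (4 * besselK α x ^ 2)
      = ∫⁻ p : ℝ, ∫⁻ t : ℝ,
          ENNReal.ofReal (exp (-(x * (2 * cosh t * cosh (p / 2))) + α * p)) := by
  have h0 : ENNReal.ofReal (2 * besselK α x)
      = ∫⁻ t : ℝ, ENNReal.ofReal (exp (-x * cosh t + α * t)) := by
    rw [← integral_exp_neg_mul_cosh_add hx]
    exact ofReal_integral_eq_lintegral_ofReal (integrable_exp_neg_mul_cosh_add hx α)
      (ae_of_all _ fun _ => (exp_pos _).le)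
  have hpos : 0 ≤ 2 * besselK α x := by
    rw [← integral_exp_neg_mul_cosh_add hx]
    exact integral_nonneg fun _ => (exp_pos _).le
  rw [show 4 * besselK α x ^ 2 = 2 * besselK α x * (2 * besselK α x) by ring,
    ENNReal.ofReal_mul hpos, h0, ← lintegral_mul_const _ (by fun_prop)]
  have h1 : ∀ t : ℝ, ENNReal.ofReal (exp (-x * cosh t + α * t)) *
      ∫⁻ u : ℝ, ENNReal.ofReal (exp (-x * cosh u + α * u))
      = ∫⁻ p : ℝ, ENNReal.ofReal (exp (-x * (cosh t + cosh (p - t)) + α * p)) := fun t => by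
    rw [← lintegral_sub_right_eq_self _ t, ← lintegral_const_mul _ (by fun_prop)]
    refine lintegral_congr fun p => ?_
    rw [← ENNReal.ofReal_mul (exp_pos _).le, ← exp_add]
    congr 2
    ring
  simp_rw [h1]
  rw [lintegral_lintegral_swap (by fun_prop)]
  refine lintegral_congr fun p => ?_
  rw [← lintegral_add_right_eq_self _ (p / 2)]
  refine lintegral_congr fun t => ?_
  congr 2
  rw [show p - (t + p / 2) = p / 2 - t by ring, cosh_add, cosh_sub]
  ring

theorem lintegral_rpow_mul_besselK_sq {b s α : ℝ} (hb : 0 < b) (h1 : 0 < s / 2 + α)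
    (h2 : 0 < s / 2 - α) :
    ∫⁻ x in Set.Ioi (0:ℝ), ENNReal.ofReal (x ^ (s - 1) * besselK α (b * x) ^ 2)
      = ENNReal.ofReal (b ^ (-s) * 2 ^ s / 8 *
          (Gamma (s / 2) ^ 2 * Gamma (s / 2 + α) * Gamma (s / 2 - α) / Gamma s)) := by
  have hs : 0 < s := by linarith
  have hG : 0 < Gamma s := Gamma_pos_of_pos hs
  have key : ∫⁻ w : ℝ, ENNReal.ofReal (exp (s * w)) *
        ENNReal.ofReal (4 * besselK α (b * exp w) ^ 2)
      = ENNReal.ofReal (Gamma s * (2 * b) ^ (-s)) *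
        (ENNReal.ofReal (2 ^ s * (Gamma (s / 2 + α) * Gamma (s / 2 - α) / Gamma s)) *
        ENNReal.ofReal (2 ^ s * (Gamma (s / 2) ^ 2 / Gamma s) / 2)) := by
    have e1 : ∀ w : ℝ, ENNReal.ofReal (exp (s * w)) *
        ENNReal.ofReal (4 * besselK α (b * exp w) ^ 2)
        = ∫⁻ p : ℝ, ∫⁻ t : ℝ, ENNReal.ofReal
            (exp (-(2 * b * cosh t * cosh (p / 2) * exp w) + s * w)) *
            ENNReal.ofReal (exp (α * p)) := fun w => by
      rw [ofReal_four_mul_besselK_sq (mul_pos hb (exp_pos w)),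
        ← lintegral_const_mul _ (by fun_prop)]
      refine lintegral_congr fun p => ?_
      rw [← lintegral_const_mul _ (by fun_prop)]
      refine lintegral_congr fun t => ?_
      rw [← ENNReal.ofReal_mul (exp_pos _).le, ← ENNReal.ofReal_mul (exp_pos _).le,
        ← exp_add, ← exp_add]
      congr 2
      ring
    simp_rw [e1]
    rw [lintegral_lintegral_swap (by fun_prop)]
    have e2 : ∀ p : ℝ, ∫⁻ w : ℝ, ∫⁻ t : ℝ, ENNReal.ofReal
            (exp (-(2 * b * cosh t * cosh (p / 2) * exp w) + s * w)) *
            ENNReal.ofReal (exp (α * p))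
        = ENNReal.ofReal (Gamma s * (2 * b) ^ (-s)) *
          (ENNReal.ofReal (exp (α * p) * cosh (p / 2) ^ (-s)) *
            ∫⁻ t : ℝ, ENNReal.ofReal (cosh t ^ (-s))) := fun p => by
      rw [lintegral_lintegral_swap (by fun_prop), ← lintegral_const_mul _ (by fun_prop),
        ← lintegral_const_mul _ (by fun_prop)]
      refine lintegral_congr fun t => ?_
      have ct := cosh_pos t
      have cp := cosh_pos (p / 2)
      rw [lintegral_mul_const _ (by fun_prop), lintegral_exp_neg_mul_exp_add hs (by positivity),
        ← ENNReal.ofReal_mul (by positivity), ← ENNReal.ofReal_mul (by positivity),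
        ← ENNReal.ofReal_mul (by positivity), mul_rpow (by positivity) cp.le,
        mul_rpow (by positivity) ct.le]
      congr 1
      ring
    simp_rw [e2]
    rw [lintegral_const_mul _ (by fun_prop), lintegral_mul_const _ (by fun_prop),
      lintegral_exp_mul_cosh_half_rpow h1 h2, lintegral_cosh_rpow hs]
  have hl : ENNReal.ofReal 4 * ∫⁻ x in Set.Ioi (0:ℝ),
      ENNReal.ofReal (x ^ (s - 1) * besselK α (b * x) ^ 2)
      = ∫⁻ w : ℝ, ENNReal.ofReal (exp (s * w)) *
        ENNReal.ofReal (4 * besselK α (b * exp w) ^ 2) := by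
    rw [lintegral_Ioi_zero_eq_lintegral_exp, ← lintegral_const_mul' _ _ ENNReal.ofReal_ne_top]
    refine lintegral_congr fun w => ?_
    rw [← ENNReal.ofReal_mul (exp_pos _).le, ← ENNReal.ofReal_mul (by norm_num),
      ← ENNReal.ofReal_mul (exp_pos _).le, ← exp_mul]
    congr 1
    rw [show s * w = w + w * (s - 1) by ring, exp_add]
    ring
  have g1 := Gamma_pos_of_pos h1
  have g2 := Gamma_pos_of_pos h2
  rw [key, ← ENNReal.ofReal_mul (by positivity), ← ENNReal.ofReal_mul (by positivity)] at hl
  have h4 : ENNReal.ofReal 4 ≠ 0 := by simp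
  rw [← ENNReal.mul_right_inj h4 ENNReal.ofReal_ne_top, hl, ← ENNReal.ofReal_mul (by norm_num)]
  congr 1
  rw [mul_rpow two_pos.le hb.le, rpow_neg two_pos.le]
  field_simp
  ring

end MellinSquare

section BesselK

lemma besselK_neg (ν x : ℝ) : besselK (-ν) x = besselK ν x := by simp [besselK]

lemma besselK_nonneg (ν x : ℝ) : 0 ≤ besselK ν x :=
  setIntegral_nonneg measurableSet_Ioi fun t _ => by have := cosh_pos (ν * t); positivity

lemma besselK_le_of_abs_le {μ ν x : ℝ} (hx : 0 < x) (h : |μ| ≤ |ν|) :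
    besselK μ x ≤ besselK ν x := by
  refine setIntegral_mono_on (integrable_exp_neg_mul_cosh_mul_cosh hx μ).integrableOn
    (integrable_exp_neg_mul_cosh_mul_cosh hx ν).integrableOn measurableSet_Ioi fun t _ => ?_
  refine mul_le_mul_of_nonneg_left (cosh_le_cosh.2 ?_) (exp_pos _).le
  rw [abs_mul, abs_mul]
  gcongr

lemma besselK_add_one_sub {x : ℝ} (hx : 0 < x) (ν : ℝ) :
    besselK (ν + 1) x - besselK (ν - 1) x = 2 * ν / x * besselK ν x := by
  have hi := fun μ : ℝ => (integrable_exp_neg_mul_cosh_mul_cosh hx μ).integrableOn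
    (s := Set.Ioi (0:ℝ))
  have hd : ∀ t ∈ Set.Ioi (0:ℝ), HasDerivAt (fun t => exp (-x * cosh t) * sinh (ν * t))
      (-(x / 2) * (exp (-x * cosh t) * cosh ((ν + 1) * t) - exp (-x * cosh t) * cosh ((ν - 1) * t))
        + ν * (exp (-x * cosh t) * cosh (ν * t))) t := fun t _ => by
    have h1 := ((hasDerivAt_cosh t).const_mul (-x)).exp
    have h2 : HasDerivAt (fun t => sinh (ν * t)) (cosh (ν * t) * ν) t := by
      simpa using ((hasDerivAt_id t).const_mul ν).sinh
    convert! h1.mul h2 using 1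
    rw [add_mul, sub_mul, one_mul, cosh_add, cosh_sub]
    ring
  have hsub : IntegrableOn (fun t => -(x / 2) * (exp (-x * cosh t) * cosh ((ν + 1) * t)
      - exp (-x * cosh t) * cosh ((ν - 1) * t))) (Set.Ioi 0) :=
    ((hi (ν + 1)).sub (hi (ν - 1))).const_mul (-(x / 2))
  have hint := hsub.add ((hi ν).const_mul ν)
  have hF : IntegrableOn (fun t => exp (-x * cosh t) * sinh (ν * t)) (Set.Ioi 0) :=
    (hi ν).mono' (by fun_prop) (ae_of_all _ fun t => by
      rw [norm_mul, norm_of_nonneg (exp_pos _).le]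
      refine mul_le_mul_of_nonneg_left ?_ (exp_pos _).le
      rw [norm_eq_abs, abs_sinh, ← cosh_abs]
      exact (sinh_lt_cosh _).le)
  have hlim := tendsto_zero_of_hasDerivAt_of_integrableOn_Ioi hd hint hF
  have h := integral_Ioi_of_hasDerivAt_of_tendsto (by fun_prop) hd hint hlim
  rw [integral_add hsub ((hi ν).const_mul ν),
    integral_const_mul, integral_const_mul, integral_sub (hi _) (hi _)] at h
  change -(x / 2) * (besselK (ν + 1) x - besselK (ν - 1) x) + ν * besselK ν x = _ at h
  simp only [mul_zero, sinh_zero, sub_zero] at h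
  field_simp
  linarith

lemma hasDerivAt_besselK {x : ℝ} (hx : 0 < x) (ν : ℝ) :
    HasDerivAt (besselK ν) (-(besselK (ν + 1) x + besselK (ν - 1) x) / 2) x := by
  have hi := fun μ : ℝ => fun y : ℝ => fun hy : 0 < y =>
    (integrable_exp_neg_mul_cosh_mul_cosh hy μ).integrableOn (s := Set.Ioi (0:ℝ))
  have hc : ∀ t : ℝ, cosh t * cosh (ν * t) = (cosh ((ν + 1) * t) + cosh ((ν - 1) * t)) / 2 := by
    intro t
    rw [add_mul, sub_mul, one_mul, cosh_add, cosh_sub]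
    ring
  have h := (hasDerivAt_integral_of_dominated_loc_of_deriv_le
    (μ := volume.restrict (Set.Ioi (0:ℝ)))
    (F := fun y t => exp (-y * cosh t) * cosh (ν * t))
    (F' := fun y t => -(exp (-y * cosh t) * (cosh t * cosh (ν * t))))
    (bound := fun t => exp (-(x / 2) * cosh t) * ((cosh ((ν + 1) * t) + cosh ((ν - 1) * t)) / 2))
    (Ioi_mem_nhds (half_lt_self hx)) (Eventually.of_forall fun y => by fun_prop) (hi ν x hx)
    (by fun_prop) (ae_of_all _ fun t y (hy : x / 2 < y) => ?_) ?_
    (ae_of_all _ fun t y _ => ?_)).2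
  · convert! h using 1
    simp_rw [integral_neg, hc, mul_div_assoc', mul_add]
    rw [integral_div, integral_add (hi _ x hx) (hi _ x hx), neg_div]
    rfl
  · have h1 := cosh_pos t
    have h2 := cosh_pos (ν * t)
    rw [norm_neg, norm_of_nonneg (by positivity), ← hc]
    gcongr
  · simpa only [mul_div_assoc', mul_add, Pi.add_apply] using!
      ((hi (ν + 1) _ (half_pos hx)).add (hi (ν - 1) _ (half_pos hx))).div_const 2
  · have h1 : HasDerivAt (fun y => -y * cosh t) (-cosh t) y := by
      simpa using (hasDerivAt_id y).neg.mul_const (cosh t)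
    convert! h1.exp.mul_const (cosh (ν * t)) using 1
    ring

lemma tendsto_rpow_mul_besselK {μ : ℝ} (hμ : 0 < μ) :
    Tendsto (fun x => x ^ μ * besselK μ x) (𝓝[>] 0) (𝓝 (2 ^ (μ - 1) * Gamma μ)) := by
  have hint := integrable_exp_neg_mul_exp_add hμ (half_pos one_pos)
  have hval : ∫ p : ℝ, exp (-(1 / 2 * exp p) + μ * p) = 2 * (2 ^ (μ - 1) * Gamma μ) := by
    have h := lintegral_exp_neg_mul_exp_add hμ (half_pos one_pos)
    rw [← ofReal_integral_eq_lintegral_ofReal hint (ae_of_all _ fun _ => (exp_pos _).le),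
      ENNReal.ofReal_eq_ofReal_iff (integral_nonneg fun _ => (exp_pos _).le)
        (by have := Gamma_pos_of_pos hμ; positivity)] at h
    rw [h, rpow_sub_one two_ne_zero, one_div, inv_rpow two_pos.le, rpow_neg two_pos.le, inv_inv]
    ring
  have h := tendsto_integral_filter_of_dominated_convergence (μ := volume) (l := 𝓝[>] (0:ℝ))
    (F := fun x p => exp (-((exp p + x ^ 2 * exp (-p)) / 2) + μ * p))
    (f := fun p => exp (-(1 / 2 * exp p) + μ * p))
    (fun p => exp (-(1 / 2 * exp p) + μ * p))
    (Eventually.of_forall fun x => by fun_prop)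
    (Eventually.of_forall fun x => ae_of_all _ fun p => by
      rw [norm_of_nonneg (exp_pos _).le, exp_le_exp]
      nlinarith [mul_nonneg (sq_nonneg x) (exp_pos (-p)).le])
    hint
    (ae_of_all _ fun p => by
      have hc : Continuous fun x : ℝ => exp (-((exp p + x ^ 2 * exp (-p)) / 2) + μ * p) := by
        fun_prop
      have := (hc.tendsto 0).mono_left (nhdsWithin_le_nhds (s := Set.Ioi 0))
      convert! this using 3
      ring)
  rw [hval] at h
  have h2 := h.const_mul (1 / 2)
  rw [show 1 / 2 * (2 * (2 ^ (μ - 1) * Gamma μ)) = 2 ^ (μ - 1) * Gamma μ by ring] at h2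
  refine h2.congr' ?_
  filter_upwards [self_mem_nhdsWithin] with x (hx : 0 < x)
  have hk := integral_exp_neg_mul_cosh_add hx μ
  rw [← integral_sub_right_eq_self _ (log x)] at hk
  have e : ∀ p : ℝ, exp (-((exp p + x ^ 2 * exp (-p)) / 2) + μ * p)
      = x ^ μ * exp (-x * cosh (p - log x) + μ * (p - log x)) := fun p => by
    rw [rpow_def_of_pos hx, ← exp_add, cosh_eq, neg_sub, exp_sub, exp_sub, exp_log hx, exp_neg]
    congr 1
    field_simp
    ring
  simp_rw [e]
  rw [integral_const_mul, hk]
  ring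

end BesselK

section BesselISeries

/-- The entire function `z ↦ ∑ zᵏ / (k! Γ(ν + k + 1))`, for which
`I_ν(x) = (x / 2) ^ ν * besselISeries ν (x ^ 2 / 4)`. -/
noncomputable def besselISeries (ν z : ℝ) : ℝ :=
  ∑' k : ℕ, z ^ k / ((k.factorial : ℝ) * Gamma (ν + k + 1))

lemma Gamma_add_natCast_add_one_pos {ν : ℝ} (hν : -1 < ν) (k : ℕ) : 0 < Gamma (ν + k + 1) :=
  Gamma_pos_of_pos (by have : (0:ℝ) ≤ k := k.cast_nonneg; linarith)

lemma summable_besselISeries {ν : ℝ} (hν : -1 < ν) (z : ℝ) :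
    Summable fun k : ℕ => z ^ k / ((k.factorial : ℝ) * Gamma (ν + k + 1)) := by
  refine summable_of_ratio_norm_eventually_le (r := 1 / 2) (by norm_num) ?_
  obtain ⟨N, hN⟩ := exists_nat_gt (2 * |z| - ν)
  filter_upwards [eventually_ge_atTop N] with k hk
  have hkN : (N : ℝ) ≤ k := by exact_mod_cast hk
  have hk0 : (0:ℝ) ≤ k := k.cast_nonneg
  have hp : 0 < ν + k + 1 := by linarith
  have hG := Gamma_add_natCast_add_one_pos hν k
  have hf : (0:ℝ) < k.factorial := by exact_mod_cast k.factorial_pos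
  have e : ((k + 1).factorial : ℝ) * Gamma (ν + (k + 1 : ℕ) + 1)
      = (k + 1) * (ν + k + 1) * (k.factorial * Gamma (ν + k + 1)) := by
    rw [Nat.factorial_succ]
    push_cast
    rw [show ν + (k + 1) + 1 = ν + k + 1 + 1 by ring, Gamma_add_one hp.ne']
    ring
  have en : ‖z ^ (k + 1) / ((k + 1) * (ν + k + 1) * (k.factorial * Gamma (ν + k + 1)))‖
      = |z| / ((k + 1) * (ν + k + 1)) * ‖z ^ k / (k.factorial * Gamma (ν + k + 1))‖ := by
    rw [pow_succ, mul_comm (z ^ k) z, mul_div_mul_comm, norm_mul, norm_div, norm_eq_abs z,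
      norm_of_nonneg (by positivity : 0 ≤ (k + 1 : ℝ) * (ν + k + 1))]
  rw [e, en]
  refine mul_le_mul_of_nonneg_right ?_ (norm_nonneg _)
  rw [div_le_div_iff₀ (by positivity) two_pos]
  nlinarith [abs_nonneg z]

lemma hasDerivAt_besselISeries {ν : ℝ} (hν : -1 < ν) (z : ℝ) :
    HasDerivAt (besselISeries ν) (besselISeries (ν + 1) z) z := by
  have hR : 0 < |z| + 1 := by positivity
  have hu : Summable fun k : ℕ => (k : ℝ) * (|z| + 1) ^ (k - 1) /
      ((k.factorial : ℝ) * Gamma (ν + k + 1)) := by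
    rw [← summable_nat_add_iff 1]
    refine (summable_besselISeries (show -1 < ν + 1 by linarith) (|z| + 1)).congr fun k => ?_
    rw [Nat.factorial_succ, Nat.add_sub_cancel]
    push_cast
    rw [show ν + (k + 1) + 1 = ν + 1 + k + 1 by ring]
    have : (0:ℝ) < k.factorial := by exact_mod_cast k.factorial_pos
    have := Gamma_add_natCast_add_one_pos (show -1 < ν + 1 by linarith) k
    field_simp
  have h := hasDerivAt_tsum_of_isPreconnected (𝕜 := ℝ) (F := ℝ)
    (g := fun (k : ℕ) y => y ^ k / ((k.factorial : ℝ) * Gamma (ν + k + 1)))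
    (g' := fun k y => (k : ℝ) * y ^ (k - 1) / ((k.factorial : ℝ) * Gamma (ν + k + 1)))
    (t := Metric.ball 0 (|z| + 1)) (y₀ := z) (y := z) hu Metric.isOpen_ball
    (convex_ball (0:ℝ) _).isPreconnected
    (fun k y _ => (hasDerivAt_pow k y).div_const _) (fun k y hy => ?_)
    (by simp) (summable_besselISeries hν z) (by simp)
  · convert! h using 1
    have hs : Summable fun k : ℕ => (k : ℝ) * z ^ (k - 1) /
        ((k.factorial : ℝ) * Gamma (ν + k + 1)) := by
      refine Summable.of_norm_bounded hu fun k => ?_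
      have := Gamma_add_natCast_add_one_pos hν k
      rw [norm_div, norm_mul, norm_pow, norm_of_nonneg (by positivity :
        0 ≤ (k.factorial : ℝ) * Gamma (ν + k + 1)), norm_of_nonneg (k.cast_nonneg : (0:ℝ) ≤ k)]
      gcongr
      rw [norm_eq_abs]
      linarith
    rw [hs.tsum_eq_zero_add, besselISeries]
    simp only [Nat.cast_zero, zero_mul, zero_div, zero_add]
    refine tsum_congr fun k => ?_
    rw [Nat.factorial_succ, Nat.add_sub_cancel]
    push_cast
    rw [show ν + (k + 1) + 1 = ν + 1 + k + 1 by ring]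
    have : (0:ℝ) < k.factorial := by exact_mod_cast k.factorial_pos
    have := Gamma_add_natCast_add_one_pos (show -1 < ν + 1 by linarith) k
    field_simp
  · have := Gamma_add_natCast_add_one_pos hν k
    rw [norm_div, norm_mul, norm_pow, norm_of_nonneg (by positivity :
      0 ≤ (k.factorial : ℝ) * Gamma (ν + k + 1)), norm_of_nonneg (k.cast_nonneg : (0:ℝ) ≤ k)]
    have hy' : ‖y‖ ≤ |z| + 1 := (mem_ball_zero_iff.1 hy).le
    gcongr

lemma besselISeries_recurrence {ν : ℝ} (hν : -1 < ν) (z : ℝ) :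
    z * besselISeries (ν + 2) z = besselISeries ν z - (ν + 1) * besselISeries (ν + 1) z := by
  have h0 := summable_besselISeries hν z
  have h1 := summable_besselISeries (show -1 < ν + 1 by linarith) z
  have h2 := summable_besselISeries (show -1 < ν + 2 by linarith) z
  have hs := h0.sub (h1.mul_left (ν + 1))
  have e : besselISeries ν z - (ν + 1) * besselISeries (ν + 1) z
      = ∑' k : ℕ, (z ^ k / ((k.factorial : ℝ) * Gamma (ν + k + 1)) -
        (ν + 1) * (z ^ k / ((k.factorial : ℝ) * Gamma (ν + 1 + k + 1)))) := by
    rw [(h0.hasSum.sub (h1.hasSum.mul_left (ν + 1))).tsum_eq]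
    rfl
  have hG : ∀ k : ℕ, Gamma (ν + 1 + k + 1) = (ν + k + 1) * Gamma (ν + k + 1) := fun k => by
    rw [show ν + 1 + k + 1 = ν + k + 1 + 1 by ring, Gamma_add_one]
    have : (0:ℝ) ≤ k := k.cast_nonneg
    linarith
  rw [e, hs.tsum_eq_zero_add, besselISeries, ← tsum_mul_left]
  have hz : z ^ 0 / (((0:ℕ).factorial : ℝ) * Gamma (ν + (0:ℕ) + 1)) -
        (ν + 1) * (z ^ 0 / (((0:ℕ).factorial : ℝ) * Gamma (ν + 1 + (0:ℕ) + 1))) = 0 := by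
    rw [hG]
    have := Gamma_add_natCast_add_one_pos hν 0
    have h3 : ν + 1 ≠ 0 := by linarith
    simp only [Nat.cast_zero, add_zero] at this ⊢
    field_simp
    simp
  rw [hz, zero_add]
  refine tsum_congr fun k => ?_
  have hk : (0:ℝ) ≤ k := k.cast_nonneg
  rw [hG, Nat.factorial_succ]
  push_cast
  rw [show ν + 2 + k + 1 = (ν + (k + 1) + 1) + 1 by ring, Gamma_add_one (by linarith)]
  have : (0:ℝ) < k.factorial := by exact_mod_cast k.factorial_pos
  have h4 : ν + (k + 1) + 1 ≠ 0 := by linarith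
  have := Gamma_add_natCast_add_one_pos hν (k + 1)
  push_cast at this
  have := this.ne'
  field_simp
  ring

lemma besselISeries_zero (ν : ℝ) : besselISeries ν 0 = 1 / Gamma (ν + 1) := by
  rw [besselISeries, tsum_eq_single 0 (fun k hk => by simp [hk])]
  simp

lemma poch_mul_Gamma {u : ℝ} (hu : 0 < u) (k : ℕ) : poch u k * Gamma u = Gamma (u + k) := by
  induction k with
  | zero => simp [poch]
  | succ k ih =>
    have hk : (0:ℝ) ≤ k := k.cast_nonneg
    have hs : poch u (k + 1) = poch u k * (u + k) := Finset.prod_range_succ _ _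
    push_cast
    rw [← add_assoc, Gamma_add_one (by linarith), ← ih, hs]
    ring

lemma ascPochhammer_eval_eq_poch (u : ℝ) (k : ℕ) :
    (ascPochhammer ℝ k).eval u = poch u k := by
  induction k with
  | zero => simp [poch]
  | succ k ih =>
    rw [ascPochhammer_succ_right, Polynomial.eval_mul, ih]
    simp [poch, Finset.prod_range_succ]

lemma choose_add_natCast_eq_Gamma {y : ℝ} (hy : -1 < y) (n : ℕ) :
    Ring.choose (y + n) n = Gamma (y + n + 1) / (n.factorial * Gamma (y + 1)) := by
  have h := Ring.factorial_nsmul_multichoose_eq_ascPochhammer (y + 1) n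
  rw [Polynomial.ascPochhammer_smeval_eq_eval, ascPochhammer_eval_eq_poch,
    Ring.multichoose_eq, nsmul_eq_mul, show y + 1 + n - 1 = y + n by ring] at h
  have hp := poch_mul_Gamma (show 0 < y + 1 by linarith) n
  have hG : 0 < Gamma (y + 1) := Gamma_pos_of_pos (by linarith)
  have hf : (0:ℝ) < n.factorial := by exact_mod_cast n.factorial_pos
  rw [eq_div_iff (by positivity), show y + n + 1 = y + 1 + n by ring, ← hp, ← h]
  ring

lemma sum_antidiagonal_one_div_Gamma {μ ν : ℝ} (hμ : -1 < μ) (hν : -1 < ν) (hμν : -1 < μ + ν)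
    (k : ℕ) :
    ∑ ij ∈ Finset.HasAntidiagonal.antidiagonal k, 1 / ((ij.1.factorial : ℝ) * Gamma (μ + ij.1 + 1)) *
        (1 / ((ij.2.factorial : ℝ) * Gamma (ν + ij.2 + 1)))
      = Gamma (μ + ν + 2 * k + 1) /
        (Gamma (μ + ν + k + 1) * k.factorial * Gamma (μ + k + 1) * Gamma (ν + k + 1)) := by
  have hk : (0:ℝ) ≤ k := k.cast_nonneg
  have h := Ring.add_choose_eq (r := ν + k) (s := μ + k) k (Commute.all _ _)
  rw [show ν + k + (μ + k) = μ + ν + k + k by ring,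
    choose_add_natCast_eq_Gamma (show -1 < μ + ν + k by linarith)] at h
  have hGμ := Gamma_add_natCast_add_one_pos hμ k
  have hGν := Gamma_add_natCast_add_one_pos hν k
  have e : Gamma (μ + ν + 2 * k + 1) /
      (Gamma (μ + ν + k + 1) * k.factorial * Gamma (μ + k + 1) * Gamma (ν + k + 1))
      = Gamma (μ + ν + k + k + 1) / (k.factorial * Gamma (μ + ν + k + 1)) /
        (Gamma (μ + k + 1) * Gamma (ν + k + 1)) := by
    rw [show μ + ν + 2 * k + 1 = μ + ν + k + k + 1 by ring, div_div]
    congr 1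
    ring
  rw [e, h, Finset.sum_div]
  refine Finset.sum_congr rfl fun ij hij => ?_
  obtain ⟨i, j⟩ := ij
  have hs : (k : ℝ) = i + j := by exact_mod_cast (Finset.HasAntidiagonal.mem_antidiagonal.1 hij).symm
  simp only
  have hi := Gamma_add_natCast_add_one_pos hμ i
  have hj := Gamma_add_natCast_add_one_pos hν j
  have c1 := choose_add_natCast_eq_Gamma (y := ν + j)
    (by have : (0:ℝ) ≤ j := j.cast_nonneg; linarith) i
  have c2 := choose_add_natCast_eq_Gamma (y := μ + i)
    (by have : (0:ℝ) ≤ i := i.cast_nonneg; linarith) j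
  rw [show ν + k = ν + j + i by rw [hs]; ring, show μ + k = μ + i + j by rw [hs]; ring] at *
  rw [c1, c2]
  field_simp

lemma hasSum_besselISeries_mul {μ ν : ℝ} (hμ : -1 < μ) (hν : -1 < ν) (hμν : -1 < μ + ν) (z : ℝ) :
    HasSum (fun k : ℕ => Gamma (μ + ν + 2 * k + 1) /
        (Gamma (μ + ν + k + 1) * k.factorial * Gamma (μ + k + 1) * Gamma (ν + k + 1)) * z ^ k)
      (besselISeries μ z * besselISeries ν z) := by
  have h1 := (summable_besselISeries hμ z).norm
  have h2 := (summable_besselISeries hν z).norm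
  rw [besselISeries, besselISeries,
    tsum_mul_tsum_eq_tsum_sum_antidiagonal_of_summable_norm h1 h2]
  convert! (summable_norm_sum_mul_antidiagonal_of_summable_norm h1 h2).of_norm.hasSum using 2
    with k
  rw [← sum_antidiagonal_one_div_Gamma hμ hν hμν, Finset.sum_mul]
  refine Finset.sum_congr rfl fun ij hij => ?_
  rw [← Finset.HasAntidiagonal.mem_antidiagonal.1 hij, pow_add]
  ring

end BesselISeries

section ConnectionFormula

/-- The modified Bessel function of the first kind, for `x > 0`. -/
noncomputable def besselI (ν x : ℝ) : ℝ := (x / 2) ^ ν * besselISeries ν (x ^ 2 / 4)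

lemma besselI_add_two {ν x : ℝ} (hν : -1 < ν) (hx : 0 < x) :
    besselI (ν + 2) x = besselI ν x - 2 * (ν + 1) / x * besselI (ν + 1) x := by
  have h := besselISeries_recurrence hν (x ^ 2 / 4)
  have h2 : 0 < x / 2 := half_pos hx
  rw [besselI, besselI, besselI, rpow_add h2, rpow_add h2, rpow_one, rpow_two,
    show (x / 2) ^ ν * (x / 2) ^ 2 * besselISeries (ν + 2) (x ^ 2 / 4)
      = (x / 2) ^ ν * (x ^ 2 / 4 * besselISeries (ν + 2) (x ^ 2 / 4)) by ring, h]
  field_simp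

lemma hasDerivAt_besselI {ν x : ℝ} (hν : -1 < ν) (hx : 0 < x) :
    HasDerivAt (besselI ν) (besselI (ν + 1) x + ν / x * besselI ν x) x := by
  have h2 : 0 < x / 2 := half_pos hx
  have h1 := ((hasDerivAt_id x).div_const 2).rpow_const (p := ν) (Or.inl h2.ne')
  have h3 : HasDerivAt (fun y : ℝ => y ^ 2 / 4) (x / 2) x := by
    convert! (hasDerivAt_pow 2 x).div_const 4 using 1
    norm_num
    ring
  have h4 := (hasDerivAt_besselISeries hν (x ^ 2 / 4)).comp x h3
  convert! h1.mul h4 using 1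
  simp only [id, besselI, Function.comp, rpow_add h2, rpow_sub_one h2.ne', rpow_one]
  field_simp
  ring

lemma besselI_mul_besselK_wronskian {ν x : ℝ} (hν : -1 / 2 < ν) (hx : 0 < x) :
    x * (besselI ν x * besselK (ν + 1) x + besselI (ν + 1) x * besselK ν x) = 1 := by
  set w : ℝ → ℝ := fun x =>
    x * (besselI ν x * besselK (ν + 1) x + besselI (ν + 1) x * besselK ν x) with hw
  have hd : ∀ y ∈ Set.Ioi (0:ℝ), HasDerivAt w 0 y := fun y (hy : 0 < y) => by
    have i0 := hasDerivAt_besselI (show -1 < ν by linarith) hy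
    have i1 := hasDerivAt_besselI (show -1 < ν + 1 by linarith) hy
    have k0 := hasDerivAt_besselK hy ν
    have k1 := hasDerivAt_besselK hy (ν + 1)
    rw [add_assoc, one_add_one_eq_two, besselI_add_two (by linarith) hy] at i1
    have r0 := besselK_add_one_sub hy ν
    have r1 := besselK_add_one_sub hy (ν + 1)
    rw [add_sub_cancel_right] at r1 k1
    rw [show besselK (ν - 1) y = besselK (ν + 1) y - 2 * ν / y * besselK ν y by linarith] at k0
    rw [show besselK (ν + 1 + 1) y = besselK ν y + 2 * (ν + 1) / y * besselK (ν + 1) y by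
      linarith] at k1
    convert! (hasDerivAt_id y).mul ((i0.mul k1).add (i1.mul k0)) using 1
    simp only [id, Pi.add_apply, Pi.mul_apply]
    field_simp
    ring
  have hconst : ∀ y ∈ Set.Ioi (0:ℝ), w y = w x := fun y hy =>
    isOpen_Ioi.is_const_of_deriv_eq_zero isPreconnected_Ioi
      (fun y hy => (hd y hy).differentiableAt.differentiableWithinAt)
      (fun y hy => (hd y hy).deriv) hy hx
  have hg : ∀ μ : ℝ, -1 < μ → Tendsto (fun y : ℝ => besselISeries μ (y ^ 2 / 4)) (𝓝[>] 0)
      (𝓝 (1 / Gamma (μ + 1))) := fun μ hμ => by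
    have h1 : Tendsto (fun y : ℝ => y ^ 2 / 4) (𝓝[>] 0) (𝓝 0) := by
      have : Continuous fun y : ℝ => y ^ 2 / 4 := by fun_prop
      simpa using (this.tendsto 0).mono_left (nhdsWithin_le_nhds (s := Set.Ioi 0))
    rw [← besselISeries_zero]
    exact (hasDerivAt_besselISeries hμ 0).continuousAt.tendsto.comp h1
  have hK := tendsto_rpow_mul_besselK (show 0 < ν + 1 by linarith)
  have hid : Tendsto (fun y : ℝ => y) (𝓝[>] 0) (𝓝 0) := nhdsWithin_le_nhds
  have hK2 : Tendsto (fun y => y * (y ^ (ν + 1) * besselK ν y)) (𝓝[>] 0) (𝓝 0) := by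
    have h0 := hid.mul hK
    rw [zero_mul] at h0
    refine tendsto_of_tendsto_of_tendsto_of_le_of_le' tendsto_const_nhds h0 ?_ ?_
    · filter_upwards [self_mem_nhdsWithin] with y (hy : 0 < y)
      have := besselK_nonneg ν y
      positivity
    · filter_upwards [self_mem_nhdsWithin] with y (hy : 0 < y)
      have := besselK_le_of_abs_le hy (show |ν| ≤ |ν + 1| by
        rw [abs_of_pos (show 0 < ν + 1 by linarith), abs_le]
        constructor <;> linarith)
      gcongr
  have hlim : Tendsto w (𝓝[>] 0) (𝓝 1) := by
    have h := (((hg ν (by linarith)).mul hK).const_mul (2 ^ (-ν))).add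
      (((hg (ν + 1) (by linarith)).mul hK2).const_mul (2 ^ (-(ν + 1))))
    have hG : 0 < Gamma (ν + 1) := Gamma_pos_of_pos (by linarith)
    have e : (2:ℝ) ^ (-ν) * (1 / Gamma (ν + 1) * (2 ^ (ν + 1 - 1) * Gamma (ν + 1))) +
        2 ^ (-(ν + 1)) * (1 / Gamma (ν + 1 + 1) * 0) = 1 := by
      rw [add_sub_cancel_right, rpow_neg two_pos.le]
      field_simp
      ring
    rw [e] at h
    refine h.congr' ?_
    filter_upwards [self_mem_nhdsWithin] with y (hy : 0 < y)
    simp only [hw, besselI]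
    rw [div_rpow hy.le two_pos.le, div_rpow hy.le two_pos.le, rpow_neg two_pos.le,
      rpow_neg two_pos.le, rpow_add hy, rpow_add two_pos, rpow_one, rpow_one]
    field_simp
  refine tendsto_nhds_unique (tendsto_const_nhds.congr' ?_) hlim
  filter_upwards [self_mem_nhdsWithin] with y hy
  exact (hconst y hy).symm

lemma sin_pi_mul_ne_zero_of_abs_lt_one {α : ℝ} (h0 : α ≠ 0) (h : |α| < 1) : sin (π * α) ≠ 0 := by
  obtain ⟨h1, h2⟩ := abs_lt.1 h
  rcases lt_or_gt_of_ne h0 with hα | hα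
  · exact (sin_neg_of_neg_of_neg_pi_lt (by nlinarith [pi_pos]) (by nlinarith [pi_pos])).ne
  · exact (sin_pos_of_pos_of_lt_pi (by positivity) (by nlinarith [pi_pos])).ne'

lemma besselISeries_wronskian {α : ℝ} (h : |α| < 1) (z : ℝ) :
    z * (besselISeries (α + 1) z * besselISeries (-α) z
        - besselISeries (-α + 1) z * besselISeries α z)
      + α * (besselISeries α z * besselISeries (-α) z) = sin (π * α) / π := by
  obtain ⟨h1, h2⟩ := abs_lt.1 h
  set w : ℝ → ℝ := fun z => z * (besselISeries (α + 1) z * besselISeries (-α) z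
        - besselISeries (-α + 1) z * besselISeries α z)
      + α * (besselISeries α z * besselISeries (-α) z) with hw
  have hd : ∀ z, HasDerivAt w 0 z := fun z => by
    have a0 := hasDerivAt_besselISeries (show -1 < α by linarith) z
    have a1 := hasDerivAt_besselISeries (show -1 < α + 1 by linarith) z
    have b0 := hasDerivAt_besselISeries (show -1 < -α by linarith) z
    have b1 := hasDerivAt_besselISeries (show -1 < -α + 1 by linarith) z
    have ra := besselISeries_recurrence (show -1 < α by linarith) z
    have rb := besselISeries_recurrence (show -1 < -α by linarith) z
    rw [add_assoc, one_add_one_eq_two] at a1 b1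
    convert! ((hasDerivAt_id z).mul ((a1.mul b0).sub (b1.mul a0))).add
      ((a0.mul b0).const_mul α) using 1
    simp only [id, Pi.sub_apply, Pi.mul_apply]
    linear_combination (-besselISeries (-α) z) * ra + besselISeries α z * rb
  have hc := is_const_of_deriv_eq_zero (fun z => (hd z).differentiableAt)
    (fun z => (hd z).deriv) z 0
  change w z = _
  rw [hc]
  simp only [hw, besselISeries_zero, zero_mul, zero_add]
  rcases eq_or_ne α 0 with rfl | hα
  · simp
  have hr := Gamma_mul_Gamma_one_sub α
  have g1 : 0 < Gamma (1 - α) := Gamma_pos_of_pos (by linarith)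
  have hG : Gamma α ≠ 0 := Gamma_ne_zero fun m hm => by
    rcases Nat.eq_zero_or_pos m with rfl | hm0
    · simp at hm; exact hα hm
    · have : (1:ℝ) ≤ m := by exact_mod_cast hm0
      linarith
  have hs : sin (π * α) ≠ 0 := by
    intro hs
    rw [hs, div_zero] at hr
    exact mul_ne_zero hG g1.ne' hr
  rw [eq_div_iff hs] at hr
  rw [Gamma_add_one hα, neg_add_eq_sub]
  generalize sin (π * α) = s at hr hs ⊢
  field_simp
  linarith

theorem besselK_eq_besselI {α x : ℝ} (h0 : α ≠ 0) (h : |α| < 1 / 2) (hx : 0 < x) :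
    besselK α x = π / (2 * sin (π * α)) * (besselI (-α) x - besselI α x) := by
  obtain ⟨h1, h2⟩ := abs_lt.1 h
  have e1 := besselI_mul_besselK_wronskian (show -1 / 2 < α by linarith) hx
  have e2 := besselI_mul_besselK_wronskian (show -1 / 2 < -α by linarith) hx
  have r := besselK_add_one_sub hx α
  rw [show -α + 1 = -(α - 1) by ring, besselK_neg, besselK_neg,
    show besselK (α - 1) x = besselK (α + 1) x - 2 * α / x * besselK α x by linarith,
    show -(α - 1) = -α + 1 by ring] at e2
  have hw := besselISeries_wronskian (h.trans (by norm_num)) (x ^ 2 / 4)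
  have hx2 : 0 < x / 2 := half_pos hx
  have hwI : x * (besselI (α + 1) x * besselI (-α) x - besselI (-α + 1) x * besselI α x)
      + 2 * α * (besselI α x * besselI (-α) x) = 2 * (sin (π * α) / π) := by
    have hp : (x / 2) ^ α * (x / 2) ^ (-α) = 1 := by
      rw [← rpow_add hx2, add_neg_cancel, rpow_zero]
    simp only [besselI, rpow_add hx2, rpow_one]
    rw [← hw]
    linear_combination (2 * (x ^ 2 / 4 * (besselISeries (α + 1) (x ^ 2 / 4) *
      besselISeries (-α) (x ^ 2 / 4) - besselISeries (-α + 1) (x ^ 2 / 4) *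
      besselISeries α (x ^ 2 / 4)) + α * (besselISeries α (x ^ 2 / 4) *
      besselISeries (-α) (x ^ 2 / 4)))) * hp
  have hs := sin_pi_mul_ne_zero_of_abs_lt_one h0 (h.trans (by norm_num))
  have key : besselK α x * (2 * (sin (π * α) / π)) = besselI (-α) x - besselI α x := by
    rw [← hwI]
    field_simp at e2
    linear_combination besselI (-α) x * e1 - besselI α x * e2
  rw [← key]
  field_simp

end ConnectionFormula

section FourfoldProduct

lemma poch_succ (u : ℝ) (k : ℕ) : poch u (k + 1) = poch u k * (u + k) :=
  Finset.prod_range_succ _ _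

lemma poch_pos {u : ℝ} (hu : 0 < u) (k : ℕ) : 0 < poch u k :=
  Finset.prod_pos fun _ _ => by positivity

lemma tendsto_add_natCast_div_add_natCast (u v : ℝ) :
    Tendsto (fun k : ℕ => (u + k) / (v + k)) atTop (𝓝 1) := by
  have h := tendsto_add_mul_div_add_mul_atTop_nhds u v 1 (one_ne_zero (α := ℝ))
  simpa using h

lemma summable_hyp4F3 {a₁ a₂ a₃ a₄ b₁ b₂ b₃ z : ℝ} (ha₁ : 0 < a₁) (ha₂ : 0 < a₂) (ha₃ : 0 < a₃)
    (ha₄ : 0 < a₄) (hb₁ : 0 < b₁) (hb₂ : 0 < b₂) (hb₃ : 0 < b₃) (hz0 : 0 < z) (hz1 : z < 1) :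
    Summable fun k : ℕ => (poch a₁ k * poch a₂ k * poch a₃ k * poch a₄ k)
      / (poch b₁ k * poch b₂ k * poch b₃ k) * z ^ k / (k.factorial : ℝ) := by
  have hpos : ∀ k : ℕ, 0 < (poch a₁ k * poch a₂ k * poch a₃ k * poch a₄ k)
      / (poch b₁ k * poch b₂ k * poch b₃ k) * z ^ k / (k.factorial : ℝ) := fun k => by
    have := poch_pos ha₁ k
    have := poch_pos ha₂ k
    have := poch_pos ha₃ k
    have := poch_pos ha₄ k
    have := poch_pos hb₁ k
    have := poch_pos hb₂ k
    have := poch_pos hb₃ k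
    positivity
  refine summable_of_ratio_test_tendsto_lt_one hz1 (Eventually.of_forall fun k => (hpos k).ne') ?_
  have h := ((((tendsto_add_natCast_div_add_natCast a₁ b₁).mul
    (tendsto_add_natCast_div_add_natCast a₂ b₂)).mul
    (tendsto_add_natCast_div_add_natCast a₃ b₃)).mul
    (tendsto_add_natCast_div_add_natCast a₄ 1)).const_mul z
  rw [one_mul, one_mul, one_mul, mul_one] at h
  refine h.congr fun k => ?_
  rw [norm_of_nonneg (hpos _).le, norm_of_nonneg (hpos _).le]
  have := poch_pos ha₁ k
  have := poch_pos ha₂ k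
  have := poch_pos ha₃ k
  have := poch_pos ha₄ k
  have := poch_pos hb₁ k
  have := poch_pos hb₂ k
  have := poch_pos hb₃ k
  have : (0:ℝ) < k.factorial := by exact_mod_cast k.factorial_pos
  simp only [poch_succ, Nat.factorial_succ, pow_succ]
  push_cast
  field_simp
  ring

lemma rpow_add_two_mul_natCast {y : ℝ} (hy : 0 < y) (s : ℝ) (k : ℕ) :
    y ^ (s + 2 * k) = y ^ s * (y ^ 2) ^ k := by
  rw [rpow_add hy, ← pow_mul, ← rpow_natCast]
  push_cast
  rfl

lemma lintegral_besselI_mul_besselI_mul_besselK_sq {a b α μ ν : ℝ} (ha : 0 < a) (hab : a < b)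
    (hμ : -1 < μ) (hν : -1 < ν) (h1 : 0 < (μ + ν + 1) / 2 + α) (h2 : 0 < (μ + ν + 1) / 2 - α) :
    ∫⁻ x in Set.Ioi (0:ℝ), ENNReal.ofReal
        (besselI μ (a * x) * besselI ν (a * x) * besselK α (b * x) ^ 2)
      = ENNReal.ofReal (1 / (4 * b) * (a / b) ^ (μ + ν) *
        (Gamma ((μ + ν + 1) / 2) ^ 2 * Gamma ((μ + ν + 1) / 2 + α) * Gamma ((μ + ν + 1) / 2 - α)
          / (Gamma (μ + ν + 1) * Gamma (μ + 1) * Gamma (ν + 1))) *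
        hyp4F3 ((μ + ν + 1) / 2) ((μ + ν + 1) / 2) ((μ + ν + 1) / 2 + α) ((μ + ν + 1) / 2 - α)
          (μ + ν + 1) (μ + 1) (ν + 1) (a ^ 2 / b ^ 2)) := by
  have hb : 0 < b := ha.trans hab
  have hμν : -1 < μ + ν := by linarith
  set σ := (μ + ν + 1) / 2 with hσ
  have hσ0 : 0 < σ := by linarith
  set C := 1 / (4 * b) * (a / b) ^ (μ + ν) * (Gamma σ ^ 2 * Gamma (σ + α) * Gamma (σ - α)
          / (Gamma (μ + ν + 1) * Gamma (μ + 1) * Gamma (ν + 1))) with hC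
  have g1 := Gamma_pos_of_pos hσ0
  have g2 := Gamma_pos_of_pos h1
  have g3 := Gamma_pos_of_pos h2
  have g4 := Gamma_pos_of_pos (show 0 < μ + ν + 1 by linarith)
  have g5 := Gamma_pos_of_pos (show 0 < μ + 1 by linarith)
  have g6 := Gamma_pos_of_pos (show 0 < ν + 1 by linarith)
  have hC0 : 0 < C := by positivity
  set c : ℕ → ℝ := fun k => Gamma (μ + ν + 2 * k + 1) /
    (Gamma (μ + ν + k + 1) * k.factorial * Gamma (μ + k + 1) * Gamma (ν + k + 1)) with hc
  have hc0 : ∀ k, 0 < c k := fun k => by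
    have := Gamma_add_natCast_add_one_pos hμν k
    have := Gamma_add_natCast_add_one_pos hμ k
    have := Gamma_add_natCast_add_one_pos hν k
    have : 0 < Gamma (μ + ν + 2 * k + 1) := Gamma_pos_of_pos (by
      have : (0:ℝ) ≤ k := k.cast_nonneg
      linarith)
    positivity
  have hz0 : 0 < a ^ 2 / b ^ 2 := by positivity
  have hz1 : a ^ 2 / b ^ 2 < 1 := by
    rw [div_lt_one (by positivity)]
    gcongr
  have hpt : ∀ x ∈ Set.Ioi (0:ℝ), ENNReal.ofReal
        (besselI μ (a * x) * besselI ν (a * x) * besselK α (b * x) ^ 2)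
      = ∑' k : ℕ, ENNReal.ofReal (c k * (a / 2) ^ (μ + ν + 2 * k)) *
        ENNReal.ofReal (x ^ ((μ + ν + 2 * k + 1) - 1) * besselK α (b * x) ^ 2) := fun x hx => by
    have hx : 0 < x := hx
    have hs := ((hasSum_besselISeries_mul hμ hν hμν ((a * x) ^ 2 / 4)).mul_left
      ((a * x / 2) ^ (μ + ν))).mul_right (besselK α (b * x) ^ 2)
    have e : besselI μ (a * x) * besselI ν (a * x) * besselK α (b * x) ^ 2
        = (a * x / 2) ^ (μ + ν) * (besselISeries μ ((a * x) ^ 2 / 4) *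
          besselISeries ν ((a * x) ^ 2 / 4)) * besselK α (b * x) ^ 2 := by
      rw [besselI, besselI, rpow_add (by positivity)]
      ring
    rw [e, ← hs.tsum_eq, ENNReal.ofReal_tsum_of_nonneg (fun k => by
      have := hc0 k
      have : 0 < (a * x / 2) ^ (μ + ν) := by positivity
      have := sq_nonneg (besselK α (b * x))
      change 0 ≤ (a * x / 2) ^ (μ + ν) * (c k * _) * _
      positivity) hs.summable]
    refine tsum_congr fun k => ?_
    have := hc0 k
    rw [← ENNReal.ofReal_mul (by positivity)]
    congr 1
    rw [add_sub_cancel_right, rpow_add_two_mul_natCast (half_pos ha), rpow_add_two_mul_natCast hx,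
      mul_div_right_comm, mul_rpow (half_pos ha).le hx.le]
    change _ * (c k * _) * _ = _
    rw [show (a * x) ^ 2 / 4 = (a / 2) ^ 2 * x ^ 2 by ring, mul_pow]
    ring
  have hterm : ∀ k : ℕ, ∫⁻ x in Set.Ioi (0:ℝ),
        ENNReal.ofReal (c k * (a / 2) ^ (μ + ν + 2 * k)) *
        ENNReal.ofReal (x ^ ((μ + ν + 2 * k + 1) - 1) * besselK α (b * x) ^ 2)
      = ENNReal.ofReal (C * ((poch σ k * poch σ k * poch (σ + α) k * poch (σ - α) k)
      / (poch (μ + ν + 1) k * poch (μ + 1) k * poch (ν + 1) k) * (a ^ 2 / b ^ 2) ^ k /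
        (k.factorial : ℝ))) := fun k => by
    have hk : (0:ℝ) ≤ k := k.cast_nonneg
    have hck := hc0 k
    rw [lintegral_const_mul' _ _ ENNReal.ofReal_ne_top,
      lintegral_rpow_mul_besselK_sq hb (by linarith) (by linarith),
      ← ENNReal.ofReal_mul (by positivity)]
    congr 1
    rw [show (μ + ν + 2 * k + 1) / 2 = σ + k by rw [hσ]; ring,
      show σ + k + α = σ + α + k by ring, show σ + k - α = σ - α + k by ring,
      ← poch_mul_Gamma hσ0, ← poch_mul_Gamma h1, ← poch_mul_Gamma h2]
    simp only [hc, hC]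
    have e1 := poch_mul_Gamma (show 0 < μ + ν + 1 by linarith) k
    have e2 := poch_mul_Gamma (show 0 < μ + 1 by linarith) k
    have e3 := poch_mul_Gamma (show 0 < ν + 1 by linarith) k
    rw [show μ + ν + k + 1 = μ + ν + 1 + k by ring, show μ + k + 1 = μ + 1 + k by ring,
      show ν + k + 1 = ν + 1 + k by ring, ← e1, ← e2, ← e3]
    have p1 := poch_pos (show 0 < μ + ν + 1 by linarith) k
    have p2 := poch_pos (show 0 < μ + 1 by linarith) k
    have p3 := poch_pos (show 0 < ν + 1 by linarith) k
    have hG : 0 < Gamma (μ + ν + 2 * k + 1) := Gamma_pos_of_pos (by linarith)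
    have hf : (0:ℝ) < k.factorial := by exact_mod_cast k.factorial_pos
    have hpow : (a / 2) ^ (μ + ν + 2 * k) * (b ^ (-(μ + ν + 2 * k + 1)) *
        2 ^ (μ + ν + 2 * k + 1) / 8) = 1 / (4 * b) * (a / b) ^ (μ + ν) * (a ^ 2 / b ^ 2) ^ k := by
      rw [← div_pow, ← pow_mul, ← rpow_natCast, mul_assoc, ← rpow_add (by positivity),
        Nat.cast_mul, Nat.cast_ofNat, div_rpow ha.le two_pos.le, div_rpow ha.le hb.le,
        rpow_neg hb.le, rpow_add_one hb.ne', rpow_add_one two_ne_zero]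
      field_simp
      norm_num
    calc _ = ((a / 2) ^ (μ + ν + 2 * k) * (b ^ (-(μ + ν + 2 * k + 1)) *
        2 ^ (μ + ν + 2 * k + 1) / 8)) * (poch σ k * poch σ k * poch (σ + α) k * poch (σ - α) k
      / (poch (μ + ν + 1) k * poch (μ + 1) k * poch (ν + 1) k) / (k.factorial : ℝ)) *
        (Gamma σ ^ 2 * Gamma (σ + α) * Gamma (σ - α)
          / (Gamma (μ + ν + 1) * Gamma (μ + 1) * Gamma (ν + 1))) := by
          field_simp
      _ = _ := by
          rw [hpow]
          ring
  have hmeas : ∀ k : ℕ, AEMeasurable (fun x : ℝ =>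
      ENNReal.ofReal (c k * (a / 2) ^ (μ + ν + 2 * k)) *
        ENNReal.ofReal (x ^ ((μ + ν + 2 * k + 1) - 1) * besselK α (b * x) ^ 2))
      (volume.restrict (Set.Ioi 0)) := fun k => by
    have hK : ContinuousOn (fun x => besselK α (b * x)) (Set.Ioi 0) := fun x hx => by
      have h := (hasDerivAt_besselK (mul_pos hb hx) α).continuousAt
      exact (ContinuousAt.comp (f := fun x => b * x) h (by fun_prop)).continuousWithinAt
    have := hK.aemeasurable (μ := volume) measurableSet_Ioi
    fun_prop
  have hsum := summable_hyp4F3 hσ0 hσ0 h1 h2 (show 0 < μ + ν + 1 by linarith)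
    (show 0 < μ + 1 by linarith) (show 0 < ν + 1 by linarith) hz0 hz1
  rw [setLIntegral_congr_fun measurableSet_Ioi hpt, lintegral_tsum hmeas]
  simp_rw [hterm]
  rw [hyp4F3, ← tsum_mul_left, ENNReal.ofReal_tsum_of_nonneg (fun k => ?_) (hsum.mul_left C)]
  have := poch_pos hσ0 k
  have := poch_pos h1 k
  have := poch_pos h2 k
  have := poch_pos (show 0 < μ + ν + 1 by linarith) k
  have := poch_pos (show 0 < μ + 1 by linarith) k
  have := poch_pos (show 0 < ν + 1 by linarith) k
  positivity

lemma besselI_nonneg {ν x : ℝ} (hν : -1 < ν) (hx : 0 < x) : 0 ≤ besselI ν x :=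
  mul_nonneg (by positivity) (tsum_nonneg fun k => by
    have := Gamma_add_natCast_add_one_pos hν k
    positivity)

lemma integral_besselI_mul_besselI_mul_besselK_sq {a b α μ ν : ℝ} (ha : 0 < a) (hab : a < b)
    (hμ : -1 < μ) (hν : -1 < ν) (h1 : 0 < (μ + ν + 1) / 2 + α) (h2 : 0 < (μ + ν + 1) / 2 - α) :
    IntegrableOn (fun x => besselI μ (a * x) * besselI ν (a * x) * besselK α (b * x) ^ 2)
      (Set.Ioi 0) ∧
    ∫ x in Set.Ioi (0:ℝ), besselI μ (a * x) * besselI ν (a * x) * besselK α (b * x) ^ 2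
      = 1 / (4 * b) * (a / b) ^ (μ + ν) *
        (Gamma ((μ + ν + 1) / 2) ^ 2 * Gamma ((μ + ν + 1) / 2 + α) * Gamma ((μ + ν + 1) / 2 - α)
          / (Gamma (μ + ν + 1) * Gamma (μ + 1) * Gamma (ν + 1))) *
        hyp4F3 ((μ + ν + 1) / 2) ((μ + ν + 1) / 2) ((μ + ν + 1) / 2 + α) ((μ + ν + 1) / 2 - α)
          (μ + ν + 1) (μ + 1) (ν + 1) (a ^ 2 / b ^ 2) := by
  have hb : 0 < b := ha.trans hab
  have h := lintegral_besselI_mul_besselI_mul_besselK_sq ha hab hμ hν h1 h2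
  have hcont : ContinuousOn
      (fun x => besselI μ (a * x) * besselI ν (a * x) * besselK α (b * x) ^ 2) (Set.Ioi 0) := by
    intro x hx
    have i1 := (hasDerivAt_besselI hμ (mul_pos ha hx)).continuousAt.comp
      (f := fun x => a * x) (by fun_prop)
    have i2 := (hasDerivAt_besselI hν (mul_pos ha hx)).continuousAt.comp
      (f := fun x => a * x) (by fun_prop)
    have k := (hasDerivAt_besselK (mul_pos hb hx) α).continuousAt.comp
      (f := fun x => b * x) (by fun_prop)
    exact ((i1.mul i2).mul (k.pow 2)).continuousWithinAt
  have hm := hcont.aestronglyMeasurable (μ := volume) measurableSet_Ioi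
  have hnn : 0 ≤ᵐ[volume.restrict (Set.Ioi 0)]
      fun x => besselI μ (a * x) * besselI ν (a * x) * besselK α (b * x) ^ 2 :=
    (ae_restrict_iff' measurableSet_Ioi).2 (ae_of_all _ fun x hx =>
      mul_nonneg (mul_nonneg (besselI_nonneg hμ (mul_pos ha hx))
        (besselI_nonneg hν (mul_pos ha hx))) (sq_nonneg _))
  refine ⟨(lintegral_ofReal_ne_top_iff_integrable hm hnn).1 (h ▸ ENNReal.ofReal_ne_top), ?_⟩
  rw [integral_eq_lintegral_of_nonneg_ae hnn hm, h, ENNReal.toReal_ofReal]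
  have g1 := Gamma_pos_of_pos h1
  have g2 := Gamma_pos_of_pos h2
  have g4 := Gamma_pos_of_pos (show 0 < μ + ν + 1 by linarith)
  have g5 := Gamma_pos_of_pos (show 0 < μ + 1 by linarith)
  have g6 := Gamma_pos_of_pos (show 0 < ν + 1 by linarith)
  refine mul_nonneg (by positivity) (tsum_nonneg fun k => ?_)
  have := poch_pos (show 0 < (μ + ν + 1) / 2 by linarith) k
  have := poch_pos h1 k
  have := poch_pos h2 k
  have := poch_pos (show 0 < μ + ν + 1 by linarith) k
  have := poch_pos (show 0 < μ + 1 by linarith) k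
  have := poch_pos (show 0 < ν + 1 by linarith) k
  positivity

lemma Gamma_half_add_mul_Gamma_half_sub (α : ℝ) :
    Gamma (α + 1 / 2) * Gamma (1 / 2 - α) = π / cos (π * α) := by
  have h := Gamma_mul_Gamma_one_sub (α + 1 / 2)
  rwa [show 1 - (α + 1 / 2) = 1 / 2 - α by ring,
    show π * (α + 1 / 2) = π * α + π / 2 by ring, sin_add_pi_div_two] at h

lemma integral_besselI_sq_mul_besselK_sq {a b α : ℝ} (ha : 0 < a) (hab : a < b) (h0 : α ≠ 0)
    (hα : |α| < 1 / 4) :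
    (π / (2 * sin (π * α))) ^ 2 *
        ∫ x in Set.Ioi (0:ℝ), besselI α (a * x) * besselI α (a * x) * besselK α (b * x) ^ 2
      = π ^ 4 / (8 * b) * (1 / sin (2 * π * α)) * (1 / sin (π * α) * Gamma (2 * α + 1 / 2)
          / (Gamma (1 / 2 - α) * Gamma (1 + α) ^ 3) * (a / (2 * b)) ^ (2 * α)
          * hyp4F3 (1 / 2) (α + 1 / 2) (α + 1 / 2) (2 * α + 1 / 2)
              (2 * α + 1) (α + 1) (α + 1) (a ^ 2 / b ^ 2)) := by
  obtain ⟨h1, h2⟩ := abs_lt.1 hα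
  have hb : 0 < b := ha.trans hab
  rw [(integral_besselI_mul_besselI_mul_besselK_sq ha hab (by linarith) (by linarith)
    (by linarith) (by linarith)).2]
  rw [show (α + α + 1) / 2 = α + 1 / 2 by ring, show α + 1 / 2 + α = 2 * α + 1 / 2 by ring,
    show α + 1 / 2 - α = 1 / 2 by ring, ← two_mul, Gamma_one_half_eq]
  have hF : hyp4F3 (α + 1 / 2) (α + 1 / 2) (2 * α + 1 / 2) (1 / 2)
              (2 * α + 1) (α + 1) (α + 1) (a ^ 2 / b ^ 2)
      = hyp4F3 (1 / 2) (α + 1 / 2) (α + 1 / 2) (2 * α + 1 / 2)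
              (2 * α + 1) (α + 1) (α + 1) (a ^ 2 / b ^ 2) :=
    tsum_congr fun k => by ring
  rw [hF]
  have hr := Gamma_half_add_mul_Gamma_half_sub α
  have hd := Gamma_mul_Gamma_add_half (α + 1 / 2)
  rw [show α + 1 / 2 + 1 / 2 = α + 1 by ring, show 2 * (α + 1 / 2) = 2 * α + 1 by ring,
    show 1 - (2 * α + 1) = -(2 * α) by ring, rpow_neg two_pos.le] at hd
  have g1 := Gamma_pos_of_pos (show 0 < α + 1 / 2 by linarith)
  have g2 := Gamma_pos_of_pos (show 0 < 1 / 2 - α by linarith)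
  have g3 := Gamma_pos_of_pos (show 0 < α + 1 by linarith)
  have g4 := Gamma_pos_of_pos (show 0 < 2 * α + 1 by linarith)
  have hc : 0 < cos (π * α) := cos_pos_of_mem_Ioo
    ⟨by nlinarith [pi_pos], by nlinarith [pi_pos]⟩
  have hs := sin_pi_mul_ne_zero_of_abs_lt_one h0 (hα.trans (by norm_num))
  rw [add_comm 1 α, mul_assoc 2 π α, sin_two_mul, ← div_div a, div_right_comm,
    div_rpow (by positivity) two_pos.le]
  have hπ := pi_pos
  have h2p : (0:ℝ) < 2 ^ (2 * α) := by positivity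
  have hG : Gamma (2 * α + 1) = Gamma (α + 1 / 2) * Gamma (α + 1) * 2 ^ (2 * α) / √π := by
    rw [hd]
    field_simp
  have hG2 : Gamma (1 / 2 - α) = π / cos (π * α) / Gamma (α + 1 / 2) := by
    rw [← hr, mul_div_cancel_left₀ _ g1.ne']
  have hsp : 0 < √π := sqrt_pos.2 hπ
  rw [hG, hG2]
  field_simp
  rw [sq_sqrt hπ.le]
  ring

theorem stmt2 (a b α : ℝ) (ha : 0 < a) (hab : a < b) (hα0 : α ≠ 0) (hα : |α| < 1 / 4) :
    (∫ x in Set.Ioi (0:ℝ), (besselK α (a * x)) ^ 2 * (besselK α (b * x)) ^ 2)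
    = (π ^ 4 / (8 * b)) * (1 / Real.sin (2 * π * α)) *
      ((1 / Real.sin (π * α)) * Real.Gamma (2 * α + 1 / 2)
          / (Real.Gamma (1 / 2 - α) * Real.Gamma (1 + α) ^ 3) * (a / (2 * b)) ^ (2 * α)
          * hyp4F3 (1 / 2) (α + 1 / 2) (α + 1 / 2) (2 * α + 1 / 2)
              (2 * α + 1) (α + 1) (α + 1) (a ^ 2 / b ^ 2)
        + (1 / Real.sin (π * α)) * Real.Gamma (1 / 2 - 2 * α)
          / (Real.Gamma (α + 1 / 2) * Real.Gamma (1 - α) ^ 3) * (a / (2 * b)) ^ (-(2 * α))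
          * hyp4F3 (1 / 2) (1 / 2 - 2 * α) (1 / 2 - α) (1 / 2 - α)
              (1 - 2 * α) (1 - α) (1 - α) (a ^ 2 / b ^ 2)
        - (2 / (π * α))
          * hyp4F3 (1 / 2) (1 / 2) (α + 1 / 2) (1 / 2 - α)
              1 (1 - α) (α + 1) (a ^ 2 / b ^ 2)) := by
  obtain ⟨h1, h2⟩ := abs_lt.1 hα
  have hb : 0 < b := ha.trans hab
  have hs := sin_pi_mul_ne_zero_of_abs_lt_one hα0 (hα.trans (by norm_num))
  have hc : 0 < cos (π * α) := cos_pos_of_mem_Ioo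
    ⟨by nlinarith [pi_pos], by nlinarith [pi_pos]⟩
  have hpp := integral_besselI_sq_mul_besselK_sq ha hab hα0 hα
  have hmm := integral_besselI_sq_mul_besselK_sq ha hab (neg_ne_zero.2 hα0)
    (by rwa [abs_neg])
  simp only [mul_neg, sin_neg, besselK_neg] at hmm
  have ipp := (integral_besselI_mul_besselI_mul_besselK_sq (α := α) (μ := α) (ν := α) ha hab
    (by linarith) (by linarith) (by linarith) (by linarith)).1
  have imm := (integral_besselI_mul_besselI_mul_besselK_sq (α := α) (μ := -α) (ν := -α) ha hab
    (by linarith) (by linarith) (by linarith) (by linarith)).1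
  obtain ⟨imp, hmp⟩ := integral_besselI_mul_besselI_mul_besselK_sq (α := α) (μ := -α) (ν := α)
    ha hab (by linarith) (by linarith) (by linarith) (by linarith)
  rw [neg_add_cancel, zero_add, rpow_zero, mul_one, Gamma_one_half_eq, sq_sqrt pi_pos.le,
    add_comm (1 / 2) α, mul_assoc π, Gamma_half_add_mul_Gamma_half_sub, Gamma_one, one_mul,
    neg_add_eq_sub] at hmp
  have hexp : ∫ x in Set.Ioi (0:ℝ), besselK α (a * x) ^ 2 * besselK α (b * x) ^ 2
      = (π / (2 * sin (π * α))) ^ 2 *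
        ((∫ x in Set.Ioi (0:ℝ), besselI α (a * x) * besselI α (a * x) * besselK α (b * x) ^ 2) +
        (∫ x in Set.Ioi (0:ℝ), besselI (-α) (a * x) * besselI (-α) (a * x) *
          besselK α (b * x) ^ 2) -
        2 * ∫ x in Set.Ioi (0:ℝ), besselI (-α) (a * x) * besselI α (a * x) *
          besselK α (b * x) ^ 2) := by
    have isum : IntegrableOn (fun x => besselI α (a * x) * besselI α (a * x) *
        besselK α (b * x) ^ 2 + besselI (-α) (a * x) * besselI (-α) (a * x) *
          besselK α (b * x) ^ 2) (Set.Ioi 0) := ipp.add imm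
    rw [← integral_const_mul 2, ← integral_add ipp imm, ← integral_sub isum (imp.const_mul 2),
      ← integral_const_mul]
    refine setIntegral_congr_fun measurableSet_Ioi fun x hx => ?_
    rw [besselK_eq_besselI hα0 (hα.trans (by norm_num)) (mul_pos ha hx)]
    ring
  have hG : Gamma (1 - α) * Gamma (α + 1) = π * α / sin (π * α) := by
    rw [Gamma_add_one hα0, mul_div_right_comm, ← Gamma_mul_Gamma_one_sub]
    ring
  have hF : hyp4F3 (1 / 2) (-α + 1 / 2) (-α + 1 / 2) (-(2 * α) + 1 / 2)
              (-(2 * α) + 1) (-α + 1) (-α + 1) (a ^ 2 / b ^ 2)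
      = hyp4F3 (1 / 2) (1 / 2 - 2 * α) (1 / 2 - α) (1 / 2 - α)
              (1 - 2 * α) (1 - α) (1 - α) (a ^ 2 / b ^ 2) := by
    simp only [neg_add_eq_sub]
    exact tsum_congr fun k => by ring
  rw [hF] at hmm
  simp only [neg_add_eq_sub, sub_neg_eq_add, ← sub_eq_add_neg, add_comm (1 / 2) α] at hmm
  rw [hexp, mul_sub, mul_add, hpp, hmp, hG]
  have hmm' : (π / (2 * sin (π * α))) ^ 2 * ∫ x in Set.Ioi (0:ℝ), besselI (-α) (a * x) *
      besselI (-α) (a * x) * besselK α (b * x) ^ 2 = _ := Eq.trans (by ring) hmm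
  rw [hmm', mul_assoc 2 π α, sin_two_mul]
  have hπ := pi_pos
  field_simp
  ring

end FourfoldProduct
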